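/- arXiv:2410.20020 — 3 statements merged into one kernel-verified Lean document; each statement's English description precedes it below -/
import Mathlib

section
/- (Russo's Lemma over F_q) For any monotone decreasing function f : F_q^n → {0,1}, the derivative with respect to p of E_{z∼p}[f(z)] is at most −(1/(q−1))·E_{z∼p}[h_f(z)], where h_f(z) counts, when f(z)=1, the number of coordinates i with z_i = 0 such that there exists a ≠ 0 with f(z with i-th coordinate set to a) = 0, and h_f(z)=0 when f(z)=0. -/
open Finset

/-- Expectation of `f` under the q-ary `p`-noisy distribution on `F_q^n`. -/
noncomputable def noisyExp (q n : ℕ) [NeZero q] (p : ℝ) (f : (Fin n → ZMod q) → ℝ) : ℝ :=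
  ∑ z : Fin n → ZMod q, (∏ i, if z i = 0 then 1 - p else p / (q - 1)) * f z

/-- `f` is monotone decreasing. -/
def MonoDec (q n : ℕ) [NeZero q] (f : (Fin n → ZMod q) → ℝ) : Prop :=
  ∀ (z : Fin n → ZMod q) (i : Fin n) (a : ZMod q), a ≠ 0 →
    f (Function.update z i a) ≤ f (Function.update z i 0)

/-- `h_f(z)`: if `f z = 1`, the number of coordinates `i` with `z i = 0` such that
setting the `i`-th coordinate to some nonzero `a` makes `f` vanish; `0` otherwise. -/
noncomputable def hfun (q n : ℕ) [NeZero q] (f : (Fin n → ZMod q) → ℝ)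
    (z : Fin n → ZMod q) : ℝ :=
  if f z = 1 then
    (Nat.card {i : Fin n // z i = 0 ∧ ∃ a : ZMod q, a ≠ 0 ∧ f (Function.update z i a) = 0} : ℝ)
  else 0


open Classical in
/-- The indicator that `i` contributes to `h_f(z)`. -/
noncomputable def hInd (q n : ℕ) [NeZero q] (f : (Fin n → ZMod q) → ℝ) (i : Fin n)
    (z : Fin n → ZMod q) : ℝ :=
  if f z = 1 ∧ z i = 0 ∧ ∃ a : ZMod q, a ≠ 0 ∧ f (Function.update z i a) = 0 then 1 else 0

lemma hfun_eq (q n : ℕ) [NeZero q] (f : (Fin n → ZMod q) → ℝ) (z : Fin n → ZMod q) :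
    hfun q n f z = ∑ i, hInd q n f i z := by
  classical
  unfold hfun hInd
  by_cases h : f z = 1
  · simp only [h, true_and, if_true]
    rw [Nat.card_eq_fintype_card, Fintype.card_subtype, Finset.sum_boole]
  · simp [h]

lemma inner_le (q n : ℕ) [NeZero q] (hq : 2 ≤ q)
    (f : (Fin n → ZMod q) → ℝ) (hmono : MonoDec q n f) (i : Fin n) (z : Fin n → ZMod q) :
    ∑ a : ZMod q, ((if a = 0 then (-1 : ℝ) else 1 / ((q : ℝ) - 1)) * f (Function.update z i a)
      + 1 / ((q : ℝ) - 1) * hInd q n f i (Function.update z i a)) ≤ 0 := by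
  classical
  have hq1 : (0 : ℝ) < (q : ℝ) - 1 := by
    have : (2 : ℝ) ≤ q := by exact_mod_cast hq
    linarith
  rw [← Finset.add_sum_erase _ _ (Finset.mem_univ (0 : ZMod q))]
  have h1 : ∑ a ∈ univ.erase (0 : ZMod q),
      ((if a = 0 then (-1 : ℝ) else 1 / ((q : ℝ) - 1)) * f (Function.update z i a)
      + 1 / ((q : ℝ) - 1) * hInd q n f i (Function.update z i a))
      = 1 / ((q : ℝ) - 1) * ∑ a ∈ univ.erase (0 : ZMod q), f (Function.update z i a) := by
    rw [Finset.mul_sum]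
    refine Finset.sum_congr rfl fun a ha => ?_
    have ha0 : a ≠ 0 := Finset.ne_of_mem_erase ha
    simp [hInd, ha0]
  rw [h1]
  have hcard : ((univ.erase (0 : ZMod q)).card : ℝ) = (q : ℝ) - 1 := by
    rw [Finset.card_erase_of_mem (Finset.mem_univ _), Finset.card_univ, ZMod.card,
      Nat.cast_sub (by omega)]
    simp
  have key : ∑ a ∈ univ.erase (0 : ZMod q),
      (f (Function.update z i a) - f (Function.update z i 0))
      + hInd q n f i (Function.update z i 0) ≤ 0 := by
    have hle : ∀ a ∈ univ.erase (0 : ZMod q),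
        f (Function.update z i a) - f (Function.update z i 0) ≤ 0 := fun a ha =>
      sub_nonpos.2 (hmono z i a (Finset.ne_of_mem_erase ha))
    unfold hInd
    split_ifs with h
    · obtain ⟨hf1, -, a, ha, hfa⟩ := h
      rw [Function.update_idem] at hfa
      have hmem : a ∈ univ.erase (0 : ZMod q) := by simp [ha]
      rw [← Finset.add_sum_erase _ _ hmem]
      have := Finset.sum_nonpos (s := (univ.erase (0 : ZMod q)).erase a)
        fun b hb => hle b (Finset.mem_of_mem_erase hb)
      rw [hfa, hf1] at *
      linarith
    · have := Finset.sum_nonpos hle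
      linarith
  rw [Finset.sum_sub_distrib, Finset.sum_const, nsmul_eq_mul, hcard] at key
  have h2 := mul_le_mul_of_nonneg_left key (by positivity : 0 ≤ 1 / ((q : ℝ) - 1))
  have h3 : 1 / ((q : ℝ) - 1) * ((q : ℝ) - 1) = 1 := by field_simp
  simp only [if_true]
  generalize 1 / ((q : ℝ) - 1) = c at *
  generalize f (Function.update z i 0) = F at *
  have : c * (((q : ℝ) - 1) * F) = F := by rw [← mul_assoc, h3, one_mul]
  rw [mul_zero, mul_add, mul_sub, this] at h2
  linarith

lemma sum_split (q n : ℕ) [NeZero q] (i : Fin n) (g : (Fin n → ZMod q) → ℝ) :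
    ∑ z, g z = ∑ y : {j // j ≠ i} → ZMod q, ∑ a : ZMod q,
      g (Function.update ((Equiv.funSplitAt i (ZMod q)).symm (0, y)) i a) := by
  rw [← (Equiv.funSplitAt i (ZMod q)).symm.sum_comp, Fintype.sum_prod_type, Finset.sum_comm]
  refine Finset.sum_congr rfl fun y _ => Finset.sum_congr rfl fun a _ => ?_
  congr 1
  ext j
  by_cases h : j = i
  · subst h; simp
  · simp [h]

/-- Russo's Lemma over `F_q`. -/
theorem stmt1 (q n : ℕ) [NeZero q] (hq : 2 ≤ q)
    (f : (Fin n → ZMod q) → ℝ) (hf01 : ∀ z, f z = 0 ∨ f z = 1)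
    (hmono : MonoDec q n f) (p : ℝ) (hp : p ∈ Set.Icc (0:ℝ) 1) :
    deriv (fun t => noisyExp q n t f) p ≤ -(1 / ((q : ℝ) - 1)) * noisyExp q n p (hfun q n f) := by
  classical
  have hq1 : (0 : ℝ) < (q : ℝ) - 1 := by
    have : (2 : ℝ) ≤ q := by exact_mod_cast hq
    linarith
  obtain ⟨hp0, hp1⟩ := hp
  set w : ZMod q → ℝ := fun a => if a = 0 then 1 - p else p / ((q : ℝ) - 1) with hw
  set d : ZMod q → ℝ := fun a => if a = 0 then (-1 : ℝ) else 1 / ((q : ℝ) - 1) with hd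
  have hw0 : ∀ a, 0 ≤ w a := by
    intro a
    simp only [hw]
    split_ifs
    · linarith
    · positivity
  have hder : HasDerivAt (fun t => noisyExp q n t f)
      (∑ z : Fin n → ZMod q, (∑ i, (∏ j ∈ univ.erase i, w (z j)) • d (z i)) * f z) p := by
    unfold noisyExp
    refine HasDerivAt.fun_sum fun z _ => ?_
    refine HasDerivAt.mul_const ?_ _
    refine HasDerivAt.fun_finset_prod (u := univ)
      (f := fun i t => if z i = 0 then 1 - t else t / ((q : ℝ) - 1)) fun i _ => ?_
    simp only [hd]
    split_ifs
    · simpa using (hasDerivAt_id p).const_sub 1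
    · exact (hasDerivAt_id p).div_const _
  rw [hder.deriv]
  have hR : noisyExp q n p (hfun q n f)
      = ∑ i, ∑ z : Fin n → ZMod q, (∏ j, w (z j)) * hInd q n f i z := by
    unfold noisyExp
    rw [Finset.sum_comm]
    refine Finset.sum_congr rfl fun z _ => ?_
    rw [hfun_eq, Finset.mul_sum]
  have hL : ∑ z : Fin n → ZMod q, (∑ i, (∏ j ∈ univ.erase i, w (z j)) • d (z i)) * f z
      = ∑ i, ∑ z : Fin n → ZMod q, (∏ j ∈ univ.erase i, w (z j)) * (d (z i) * f z) := by
    rw [Finset.sum_comm]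
    refine Finset.sum_congr rfl fun z _ => ?_
    rw [Finset.sum_mul]
    refine Finset.sum_congr rfl fun i _ => ?_
    rw [smul_eq_mul, mul_assoc]
  rw [hR, hL, Finset.mul_sum]
  refine Finset.sum_le_sum fun i _ => ?_
  have hA : ∑ z : Fin n → ZMod q, (∏ j, w (z j)) * hInd q n f i z
      ≤ ∑ z : Fin n → ZMod q, (∏ j ∈ univ.erase i, w (z j)) * hInd q n f i z := by
    refine Finset.sum_le_sum fun z _ => ?_
    unfold hInd
    split_ifs with h
    · rw [← Finset.mul_prod_erase _ _ (Finset.mem_univ i)]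
      have h1 : w (z i) ≤ 1 := by simp [hw, h.2.1, hp0]
      have h2 : 0 ≤ ∏ j ∈ univ.erase i, w (z j) := Finset.prod_nonneg fun j _ => hw0 _
      nlinarith
    · simp
  have hB : ∑ z : Fin n → ZMod q, (∏ j ∈ univ.erase i, w (z j)) *
      (d (z i) * f z + 1 / ((q : ℝ) - 1) * hInd q n f i z) ≤ 0 := by
    rw [sum_split q n i]
    refine Finset.sum_nonpos fun y _ => ?_
    generalize (Equiv.funSplitAt i (ZMod q)).symm (0, y) = z
    have h1 : ∀ a, ∏ j ∈ univ.erase i, w (Function.update z i a j)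
        = ∏ j ∈ univ.erase i, w (z j) := fun a =>
      Finset.prod_congr rfl fun j hj => by
        rw [Function.update_of_ne (Finset.ne_of_mem_erase hj)]
    simp only [h1, Function.update_self]
    rw [← Finset.mul_sum]
    exact mul_nonpos_of_nonneg_of_nonpos (Finset.prod_nonneg fun j _ => hw0 _)
      (inner_le q n hq f hmono i z)
  have hC : ∑ z : Fin n → ZMod q, (∏ j ∈ univ.erase i, w (z j)) *
      (d (z i) * f z + 1 / ((q : ℝ) - 1) * hInd q n f i z)
      = ∑ z : Fin n → ZMod q, (∏ j ∈ univ.erase i, w (z j)) * (d (z i) * f z)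
        + 1 / ((q : ℝ) - 1) *
          ∑ z : Fin n → ZMod q, (∏ j ∈ univ.erase i, w (z j)) * hInd q n f i z := by
    rw [Finset.mul_sum, ← Finset.sum_add_distrib]
    refine Finset.sum_congr rfl fun z _ => ?_
    ring
  have hD := mul_le_mul_of_nonneg_left hA (by positivity : 0 ≤ 1 / ((q : ℝ) - 1))
  rw [hC] at hB
  linarith
end

section
/- Let C ⊆ F_q^n be a linear code with minimum distance d_min ≥ 4q, and let g(p) = Pr_{z∼p}[z ∈ Ω] be the probability of correct maximum-likelihood decoding under q-ary p-noisy errors. Then for all p ∈ [0,1], dg/dp ≤ −((1−p)/4)·(√d_min / q^{3/2})·g(p)·(1 − g(p)). -/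
open Finset

/-- Expectation of `f` under the q-ary `p`-noisy distribution on `F^n`:
each coordinate is independently `0` with probability `1 - p` and each nonzero
element with probability `p/(q-1)` where `q = |F|`. -/
noncomputable def noisyExpF (F : Type*) [Fintype F] [DecidableEq F] [Zero F] (n : ℕ) (p : ℝ)
    (f : (Fin n → F) → ℝ) : ℝ :=
  ∑ z : Fin n → F, (∏ i, if z i = 0 then 1 - p else p / ((Fintype.card F : ℝ) - 1)) * f z

/-- The fixed total order `≺` on `F^n`: first compare Hamming weights; ties are
broken so that the vector whose support comes *after* in the lexicographic order
of supports is smaller (i.e. at the first coordinate where the supports differ,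
the smaller vector is `0` there); remaining ties are broken by the lexicographic
order on entries. -/
def precRel (F : Type*) [Zero F] [LinearOrder F] {n : ℕ} (a b : Fin n → F) : Prop :=
  hammingNorm a < hammingNorm b ∨
  (hammingNorm a = hammingNorm b ∧
    ∃ i, a i = 0 ∧ b i ≠ 0 ∧ ∀ j, j < i → (a j = 0 ↔ b j = 0)) ∨
  ((∀ i, a i = 0 ↔ b i = 0) ∧ ∃ i, a i < b i ∧ ∀ j, j < i → a j = b j)

/-- The decoding region `Ω_c` of the codeword `c` for the maximum-likelihood
decoder `D*` determined by the order `≺`: `D*(z) = c` iff `z - c` strictly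
precedes `z - c'` for every other codeword `c'`. -/
def decRegion {F : Type*} [Field F] [LinearOrder F] {n : ℕ}
    (C : Submodule F (Fin n → F)) (c : Fin n → F) : Set (Fin n → F) :=
  {z | ∀ c' ∈ C, c' ≠ c → precRel F (z - c) (z - c')}

/-- single coordinate weight -/
noncomputable def wtF (F : Type*) [Fintype F] [DecidableEq F] [Zero F] (p : ℝ) (x : F) : ℝ :=
  if x = 0 then 1 - p else p / ((Fintype.card F : ℝ) - 1)

set_option linter.unusedSectionVars false

section analysis
variable {F : Type*} [Field F] [Fintype F] [LinearOrder F]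

lemma noisy_eq (n : ℕ) (p : ℝ) (f : (Fin n → F) → ℝ) :
    noisyExpF F n p f = ∑ z : Fin n → F, (∏ i, wtF F p (z i)) * f z := rfl

lemma noisy_zero (p : ℝ) (f : (Fin 0 → F) → ℝ) :
    noisyExpF F 0 p f = f default := by
  simp [noisy_eq]

lemma noisy_succ (n : ℕ) (p : ℝ) (f : (Fin (n+1) → F) → ℝ) :
    noisyExpF F (n+1) p f =
      ∑ x : F, wtF F p x * noisyExpF F n p (fun y => f (Fin.cons x y)) := by
  simp only [noisy_eq]
  rw [← (Fin.consEquiv (fun _ : Fin (n+1) => F)).sum_comp, Fintype.sum_prod_type]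
  refine Finset.sum_congr rfl fun x _ => ?_
  rw [Finset.mul_sum]
  refine Finset.sum_congr rfl fun y _ => ?_
  simp [Fin.consEquiv, Fin.prod_univ_succ, mul_assoc]

lemma one_lt_q : (1:ℝ) < (Fintype.card F : ℝ) := by
  exact_mod_cast Fintype.one_lt_card

lemma wt_nonneg {p : ℝ} (hp : p ∈ Set.Icc (0:ℝ) 1) (x : F) : 0 ≤ wtF F p x := by
  have := one_lt_q (F := F)
  unfold wtF
  split_ifs
  · linarith [hp.2]
  · exact div_nonneg hp.1 (by linarith)

lemma sum_split_s8 (g : F → ℝ) : ∑ x, g x = g 0 + ∑ x ∈ univ.erase 0, g x := by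
  rw [Finset.add_sum_erase _ _ (mem_univ _)]

lemma wt_sum_split (p : ℝ) (g : F → ℝ) : ∑ x, wtF F p x * g x =
    (1 - p) * g 0 + p / ((Fintype.card F : ℝ) - 1) * ∑ x ∈ univ.erase 0, g x := by
  rw [sum_split_s8, Finset.mul_sum]
  congr 1
  · simp [wtF]
  · refine Finset.sum_congr rfl fun x hx => ?_
    simp [wtF, (Finset.mem_erase.1 hx).1]

lemma wt_sum (p : ℝ) : ∑ x, wtF F p x = 1 := by
  have := one_lt_q (F := F)
  have h := wt_sum_split (F := F) p (fun _ => 1)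
  simp only [mul_one] at h
  rw [h]
  have : (Fintype.card F : ℝ) - 1 ≠ 0 := by linarith
  simp [Finset.card_erase_of_mem]
  rw [Nat.cast_sub (Fintype.card_pos)]
  field_simp
  push_cast
  ring

lemma noisy_mono {n : ℕ} {p : ℝ} (hp : p ∈ Set.Icc (0:ℝ) 1) {f g : (Fin n → F) → ℝ}
    (h : ∀ z, f z ≤ g z) : noisyExpF F n p f ≤ noisyExpF F n p g := by
  simp only [noisy_eq]
  exact Finset.sum_le_sum fun z _ =>
    mul_le_mul_of_nonneg_left (h z) (Finset.prod_nonneg fun i _ => wt_nonneg hp _)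

lemma noisy_add {n : ℕ} {p : ℝ} (f g : (Fin n → F) → ℝ) :
    noisyExpF F n p (fun z => f z + g z) = noisyExpF F n p f + noisyExpF F n p g := by
  simp only [noisy_eq, mul_add, Finset.sum_add_distrib]

lemma noisy_smul {n : ℕ} {p : ℝ} (a : ℝ) (f : (Fin n → F) → ℝ) :
    noisyExpF F n p (fun z => a * f z) = a * noisyExpF F n p f := by
  simp only [noisy_eq, Finset.mul_sum]
  exact Finset.sum_congr rfl fun z _ => by ring

lemma noisy_sub {n : ℕ} {p : ℝ} (f g : (Fin n → F) → ℝ) :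
    noisyExpF F n p (fun z => f z - g z) = noisyExpF F n p f - noisyExpF F n p g := by
  simp only [noisy_eq, mul_sub, Finset.sum_sub_distrib]

lemma noisy_finsum {n : ℕ} {p : ℝ} {ι : Type*} (s : Finset ι) (f : ι → (Fin n → F) → ℝ) :
    noisyExpF F n p (fun z => ∑ k ∈ s, f k z) = ∑ k ∈ s, noisyExpF F n p (f k) := by
  simp only [noisy_eq, Finset.mul_sum]
  rw [Finset.sum_comm]

lemma noisy_const {n : ℕ} {p : ℝ} (a : ℝ) : noisyExpF F n p (fun _ => a) = a := by
  induction n with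
  | zero => rw [noisy_zero]
  | succ n ih => rw [noisy_succ]; simp only [ih]; rw [← Finset.sum_mul, wt_sum, one_mul]

/-- sum of (transformed) discrete derivatives in zero coordinates -/
noncomputable def gradF (F : Type*) [Field F] [Fintype F] [LinearOrder F] (T : ℝ → ℝ) (n : ℕ)
    (f : (Fin n → F) → ℝ) (z : Fin n → F) : ℝ :=
  ∑ i, if z i = 0 then ∑ v, T (f z - f (Function.update z i v)) else 0

lemma grad_succ (T : ℝ → ℝ) (n : ℕ) (f : (Fin (n+1) → F) → ℝ) (x : F) (y : Fin n → F) :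
    gradF F T (n+1) f (Fin.cons x y) =
      (if x = 0 then ∑ v, T (f (Fin.cons 0 y) - f (Fin.cons v y)) else 0)
      + gradF F T n (fun y => f (Fin.cons x y)) y := by
  unfold gradF
  rw [Fin.sum_univ_succ]
  simp only [Fin.cons_zero, Fin.cons_succ, Fin.update_cons_zero, ← Fin.cons_update]
  congr 1
  split_ifs with h
  · subst h; rfl
  · rfl

lemma deriv_exists (p : ℝ) (hp : p ∈ Set.Icc (0:ℝ) 1) (n : ℕ) : ∀ (f : (Fin n → F) → ℝ),
    ∃ D : ℝ, HasDerivAt (fun t => noisyExpF F n t f) D p ∧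
      (1 - p) * ((Fintype.card F : ℝ) - 1) * D = - noisyExpF F n p (gradF F id n f) ∧
      ((∀ z i, f z ≤ f (Function.update z i 0)) → D ≤ 0) := by
  have hq := one_lt_q (F := F)
  have hq' : (Fintype.card F : ℝ) - 1 ≠ 0 := by linarith
  induction n with
  | zero =>
    intro f
    refine ⟨0, ?_, ?_, fun _ => le_rfl⟩
    · simp only [noisy_zero]; exact hasDerivAt_const _ _
    · simp [noisy_zero, gradF]
  | succ n ih =>
    intro f
    choose D hD hE hM using ih
    have hw : ∀ x : F, HasDerivAt (fun t => wtF F t x)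
        (if x = 0 then -1 else 1 / ((Fintype.card F : ℝ) - 1)) p := by
      intro x
      unfold wtF
      split_ifs
      · simpa using (hasDerivAt_id p).const_sub 1
      · simpa using (hasDerivAt_id p).div_const ((Fintype.card F : ℝ) - 1)
    set φ : F → ℝ := fun x => noisyExpF F n p (fun y => f (Fin.cons x y)) with hφ
    have hfirst : ∑ x : F, (if x = 0 then -1 else 1 / ((Fintype.card F : ℝ) - 1)) * φ x
        = - (∑ v, (φ 0 - φ v)) / ((Fintype.card F : ℝ) - 1) := by
      rw [sum_split_s8]
      have : ∑ x ∈ univ.erase (0:F), (if x = 0 then -1 else 1 / ((Fintype.card F : ℝ) - 1)) * φ x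
          = 1 / ((Fintype.card F : ℝ) - 1) * ∑ x ∈ univ.erase (0:F), φ x := by
        rw [Finset.mul_sum]
        refine Finset.sum_congr rfl fun x hx => ?_
        simp [(Finset.mem_erase.1 hx).1]
      rw [this, Finset.sum_sub_distrib, sum_split_s8 φ]
      simp
      field_simp
      ring
    refine ⟨∑ x : F, ((if x = 0 then -1 else 1 / ((Fintype.card F : ℝ) - 1)) * φ x +
      wtF F p x * D (fun y => f (Fin.cons x y))), ?_, ?_, ?_⟩
    · simp only [noisy_succ]
      exact HasDerivAt.fun_sum fun x _ => (hw x).mul (hD _)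
    · rw [Finset.sum_add_distrib, hfirst, noisy_succ]
      simp only [grad_succ, noisy_add, mul_add, Finset.sum_add_distrib]
      have h2 : ∑ x, wtF F p x * noisyExpF F n p (gradF F id n fun y => f (Fin.cons x y))
          = - ((1 - p) * ((Fintype.card F : ℝ) - 1) *
            ∑ x, wtF F p x * D (fun y => f (Fin.cons x y))) := by
        rw [Finset.mul_sum, ← Finset.sum_neg_distrib]
        refine Finset.sum_congr rfl fun x _ => ?_
        have := hE (fun y => f (Fin.cons x y))
        linear_combination (wtF F p x) * this
      have h1 : ∑ x : F, wtF F p x * noisyExpF F n p (fun y => if x = 0 then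
          ∑ v, id (f (Fin.cons 0 y) - f (Fin.cons v y)) else 0) =
          (1 - p) * ∑ v, (φ 0 - φ v) := by
        rw [Finset.sum_eq_single 0]
        · simp only [wtF, if_true, id, noisy_finsum, noisy_sub, hφ]
        · intro x _ hx
          simp [hx, noisy_const]
        · simp
      rw [h1]
      have h2' : ∑ x, wtF F p x * noisyExpF F n p (fun z => gradF F id n (fun y => f (Fin.cons x y)) z)
          = _ := h2
      rw [h2']
      field_simp
      ring
    · intro hmon
      rw [Finset.sum_add_distrib, hfirst]
      have a1 : 0 ≤ ∑ v, (φ 0 - φ v) := Finset.sum_nonneg fun v _ => by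
        rw [sub_nonneg]
        refine noisy_mono hp fun y => ?_
        have := hmon (Fin.cons v y) 0
        rwa [Fin.update_cons_zero] at this
      have a2 : ∑ x, wtF F p x * D (fun y => f (Fin.cons x y)) ≤ 0 :=
        Finset.sum_nonpos fun x _ => mul_nonpos_of_nonneg_of_nonpos (wt_nonneg hp x)
          (hM _ fun y i => by
            have := hmon (Fin.cons x y) i.succ
            rwa [← Fin.cons_update] at this)
      have : - (∑ v, (φ 0 - φ v)) / ((Fintype.card F : ℝ) - 1) ≤ 0 :=
        div_nonpos_of_nonpos_of_nonneg (by linarith) (by linarith)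
      linarith

lemma onestep {p C' : ℝ} (hp : p ∈ Set.Icc (0:ℝ) 1) (hp1 : p < 1)
    (hC : (1 - p)^2 * ((Fintype.card F : ℝ) - 1) * C' = 1)
    (φ : F → ℝ) (hφ : ∀ x, φ x ∈ Set.Icc (0:ℝ) 1) :
    (∑ x, wtF F p x * φ x) * (1 - ∑ x, wtF F p x * φ x) ≤
    ∑ x, wtF F p x * √((φ x * (1 - φ x))^2 +
      (if x = 0 then C' * ∑ v, (φ 0 - φ v)^2 else 0)) := by
  have hq := one_lt_q (F := F)
  set Q : ℝ := (Fintype.card F : ℝ) - 1 with hQ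
  have hQ0 : 0 < Q := by linarith
  set S := ∑ v, (φ 0 - φ v)^2 with hS
  have hS0 : 0 ≤ S := Finset.sum_nonneg fun _ _ => sq_nonneg _
  have hSQ : S ≤ Q := by
    rw [hS, sum_split_s8]
    have : ∑ x ∈ univ.erase (0:F), (φ 0 - φ x)^2 ≤ ∑ x ∈ univ.erase (0:F), (1:ℝ) :=
      Finset.sum_le_sum fun x _ => by
        have := (hφ 0).1; have := (hφ 0).2; have := (hφ x).1; have := (hφ x).2
        nlinarith
    simp [Finset.card_erase_of_mem] at this
    rw [Nat.cast_sub Fintype.card_pos] at this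
    simp at this ⊢
    linarith
  -- variance
  have hvar : (∑ x, wtF F p x * φ x) * (1 - ∑ x, wtF F p x * φ x) ≤
      ∑ x, wtF F p x * (φ x * (1 - φ x)) + p / Q * S := by
    have e1 : ∑ x, wtF F p x * (φ 0 - φ x)^2 = p / Q * S := by
      rw [wt_sum_split, hS, sum_split_s8 (fun v => (φ 0 - φ v)^2)]; simp [hQ]
    have e2 : ∑ x, wtF F p x * (φ 0 - φ x)^2 = φ 0 ^2 - 2 * φ 0 * ∑ x, wtF F p x * φ x
        + ∑ x, wtF F p x * (φ x)^2 := by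
      have : ∀ x, wtF F p x * (φ 0 - φ x)^2 = wtF F p x * φ 0 ^2
        - 2 * φ 0 * (wtF F p x * φ x) + wtF F p x * (φ x)^2 := fun x => by ring
      simp only [this, Finset.sum_add_distrib, Finset.sum_sub_distrib, ← Finset.mul_sum,
        ← Finset.sum_mul, wt_sum, one_mul]
    have e3 : ∑ x, wtF F p x * (φ x * (1 - φ x)) = ∑ x, wtF F p x * φ x
        - ∑ x, wtF F p x * (φ x)^2 := by
      rw [← Finset.sum_sub_distrib]
      exact Finset.sum_congr rfl fun x _ => by ring
    nlinarith [sq_nonneg (φ 0 - ∑ x, wtF F p x * φ x)]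
  refine hvar.trans ?_
  rw [sum_split_s8, sum_split_s8 (fun x => wtF F p x * √((φ x * (1 - φ x))^2 +
      (if x = 0 then C' * S else 0)))]
  have hrest : ∑ x ∈ univ.erase (0:F), wtF F p x * (φ x * (1 - φ x)) ≤
      ∑ x ∈ univ.erase (0:F), wtF F p x * √((φ x * (1 - φ x))^2 +
      (if x = 0 then C' * S else 0)) := by
    refine Finset.sum_le_sum fun x hx => mul_le_mul_of_nonneg_left ?_ (wt_nonneg hp x)
    rw [if_neg (Finset.mem_erase.1 hx).1, add_zero]
    exact Real.le_sqrt_of_sq_le le_rfl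
  have hmain : (1 - p) * (φ 0 * (1 - φ 0)) + p / Q * S ≤
      (1 - p) * √((φ 0 * (1 - φ 0))^2 + C' * S) := by
    have hp' : 0 < 1 - p := by linarith
    set U := φ 0 * (1 - φ 0) with hU
    have hU0 : 0 ≤ U := mul_nonneg (hφ 0).1 (by linarith [(hφ 0).2])
    have hU1 : U ≤ 1/4 := by nlinarith [sq_nonneg (φ 0 - 1/2)]
    set s := S / Q with hs
    have hs0 : 0 ≤ s := by positivity
    have hs1 : s ≤ 1 := by rw [hs, div_le_one hQ0]; exact hSQ
    have e : C' * S = s / (1-p)^2 := by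
      rw [hs]
      field_simp
      linear_combination S * hC
    have e' : p / Q * S = p * s := by rw [hs]; ring
    rw [e', e]
    have : U + p * s / (1 - p) ≤ √(U^2 + s / (1-p)^2) := by
      apply Real.le_sqrt_of_sq_le
      have : (U + p * s / (1 - p))^2 = U^2 + (2 * U * p * s * (1-p) + p^2 * s^2) / (1-p)^2 := by
        field_simp
        ring
      rw [this]
      gcongr
      have h1 : U * (p * (1 - p)) ≤ 1/4 * (p * (1-p)) :=
        mul_le_mul_of_nonneg_right hU1 (mul_nonneg hp.1 hp'.le)
      have h2 : p^2 * s ≤ p^2 * 1 := mul_le_mul_of_nonneg_left hs1 (sq_nonneg p)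
      have h3 : 2 * (U * (p * (1-p))) + p^2 * s ≤ 1 := by nlinarith [hp.1, hp.2]
      nlinarith [mul_le_mul_of_nonneg_left h3 hs0]
    calc _ = (1 - p) * (U + p * s / (1 - p)) := by field_simp
      _ ≤ _ := mul_le_mul_of_nonneg_left this hp'.le
  have hw0 : wtF F p 0 = 1 - p := by simp [wtF]
  simp only [hw0, if_true]
  linarith

lemma minkowski {n : ℕ} {p C' : ℝ} (hp : p ∈ Set.Icc (0:ℝ) 1) (hC : 0 ≤ C')
    (X : (Fin n → F) → ℝ) (Y : F → (Fin n → F) → ℝ) :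
    √((noisyExpF F n p X)^2 + C' * ∑ v, (noisyExpF F n p (Y v))^2) ≤
      noisyExpF F n p (fun y => √((X y)^2 + C' * ∑ v, (Y v y)^2)) := by
  let V : (Fin n → F) → EuclideanSpace ℝ (Option F) := fun y =>
    WithLp.toLp 2 (fun o => o.elim (X y) (fun v => √C' * Y v y))
  have hV : ∀ y, ‖V y‖ = √((X y)^2 + C' * ∑ v, (Y v y)^2) := by
    intro y
    rw [EuclideanSpace.norm_eq]
    simp [V, mul_pow, Real.sq_sqrt hC, Finset.mul_sum]
  have hS : ‖∑ y, (∏ i, wtF F p (y i)) • V y‖ =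
      √((noisyExpF F n p X)^2 + C' * ∑ v, (noisyExpF F n p (Y v))^2) := by
    rw [EuclideanSpace.norm_eq]
    congr 1
    have h1 : ∀ v, noisyExpF F n p (fun y => √C' * Y v y) = √C' * noisyExpF F n p (Y v) :=
      fun v => noisy_smul _ _
    simp only [noisy_eq] at h1
    simp [V, noisy_eq, h1, mul_pow, Real.sq_sqrt hC, ← Finset.mul_sum]
  rw [← hS, noisy_eq]
  refine (norm_sum_le _ _).trans (Finset.sum_le_sum fun y _ => ?_)
  rw [norm_smul, Real.norm_of_nonneg (Finset.prod_nonneg fun i _ => wt_nonneg hp _), hV]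

lemma isoper {p C' : ℝ} (hp : p ∈ Set.Icc (0:ℝ) 1) (hp1 : p < 1) (hC0 : 0 ≤ C')
    (hC : (1 - p)^2 * ((Fintype.card F : ℝ) - 1) * C' = 1) (n : ℕ) :
    ∀ f : (Fin n → F) → ℝ, (∀ z, f z ∈ Set.Icc (0:ℝ) 1) →
    noisyExpF F n p f * (1 - noisyExpF F n p f) ≤
      noisyExpF F n p (fun z => √((f z * (1 - f z))^2 + C' * gradF F (fun x => x^2) n f z)) := by
  induction n with
  | zero =>
    intro f hf
    simp only [noisy_zero]
    refine Real.le_sqrt_of_sq_le ?_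
    simp [gradF]
  | succ n ih =>
    intro f hf
    rw [noisy_succ n p f, noisy_succ]
    set φ : F → ℝ := fun x => noisyExpF F n p (fun y => f (Fin.cons x y)) with hφ
    have hφ01 : ∀ x, φ x ∈ Set.Icc (0:ℝ) 1 := fun x => by
      constructor
      · have := noisy_mono hp (f := fun _ => 0) (g := fun y : Fin n → F => f (Fin.cons x y))
          (fun y => (hf _).1)
        rwa [noisy_const] at this
      · have := noisy_mono hp (g := fun _ => 1) (f := fun y : Fin n → F => f (Fin.cons x y))
          (fun y => (hf _).2)
        rwa [noisy_const] at this
    refine (onestep hp hp1 hC φ hφ01).trans ?_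
    refine Finset.sum_le_sum fun x _ => mul_le_mul_of_nonneg_left ?_ (wt_nonneg hp x)
    have hI := ih (fun y => f (Fin.cons x y)) (fun y => hf _)
    have hgn : ∀ y, 0 ≤ gradF F (fun x => x^2) n (fun y => f (Fin.cons x y)) y := fun y =>
      Finset.sum_nonneg fun i _ => by
        split_ifs
        · exact Finset.sum_nonneg fun v _ => sq_nonneg _
        · exact le_rfl
    have hφn : 0 ≤ φ x * (1 - φ x) := mul_nonneg (hφ01 x).1 (by linarith [(hφ01 x).2])
    simp only [grad_succ]
    by_cases hx : x = 0
    · subst hx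
      simp only [if_true]
      have hM := minkowski hp hC0 (fun y => √((f (Fin.cons 0 y) * (1 - f (Fin.cons 0 y)))^2 +
        C' * gradF F (fun x => x^2) n (fun y => f (Fin.cons 0 y)) y))
        (fun v y => f (Fin.cons 0 y) - f (Fin.cons v y))
      simp only [noisy_sub] at hM
      refine le_trans ?_ (hM.trans (le_of_eq ?_))
      · apply Real.sqrt_le_sqrt
        gcongr
      · congr 1
        funext y
        rw [Real.sq_sqrt (add_nonneg (sq_nonneg _) (mul_nonneg hC0 (hgn y)))]
        congr 1
        ring
    · simp only [hx, if_false, add_zero, zero_add]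
      rw [Real.sqrt_sq hφn]
      exact hI

end analysis

section comb

lemma tau_lt (k : ℕ) {n : ℕ} (S : Finset (Fin n)) (hS : ∀ j ∈ S, (j : ℕ) < k) :
    3 * ∑ j ∈ S, (4:ℤ) ^ (j : ℕ) + 1 ≤ 4 ^ k := by
  have h1 : ∑ j ∈ S, (4:ℤ) ^ (j : ℕ) ≤ ∑ j ∈ Finset.range k, (4:ℤ) ^ j := by
    rw [← Finset.sum_image (f := fun j : ℕ => (4:ℤ)^j) (g := fun j : Fin n => (j:ℕ)) (s := S)
      (fun a _ b _ h => Fin.ext h)]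
    refine Finset.sum_le_sum_of_subset_of_nonneg ?_ (fun _ _ _ => by positivity)
    intro j hj
    obtain ⟨i, hi, rfl⟩ := Finset.mem_image.1 hj
    exact Finset.mem_range.2 (hS i hi)
  have h2 : ∀ k : ℕ, 3 * ∑ j ∈ Finset.range k, (4:ℤ) ^ j + 1 = 4 ^ k := by
    intro k
    induction k with
    | zero => simp
    | succ k ih => rw [Finset.sum_range_succ, pow_succ]; linarith
  have := h2 k
  linarith

/-- coordinate cost -/
def om (n : ℕ) (i : Fin n) : ℤ := 4 ^ (n + 1) - 4 ^ (i : ℕ)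

lemma om_sum {n : ℕ} (S : Finset (Fin n)) :
    ∑ j ∈ S, om n j = (#S : ℤ) * 4 ^ (n+1) - ∑ j ∈ S, (4:ℤ) ^ (j : ℕ) := by
  simp [om, Finset.sum_sub_distrib]

lemma tau_nonneg {n : ℕ} (S : Finset (Fin n)) : 0 ≤ ∑ j ∈ S, (4:ℤ) ^ (j : ℕ) :=
  Finset.sum_nonneg fun _ _ => by positivity

lemma om_dom {n : ℕ} (A B : Finset (Fin n)) (h : #A < #B) :
    ∑ j ∈ A, om n j < ∑ j ∈ B, om n j := by
  rw [om_sum, om_sum]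
  have h1 := tau_nonneg A
  have h2 := tau_lt n B (fun j _ => j.2)
  have h3 : (#A : ℤ) + 1 ≤ #B := by exact_mod_cast h
  have h4 : (0:ℤ) < 4 ^ n := by positivity
  rw [pow_succ]
  nlinarith

lemma comb_main {n : ℕ} (A B : Finset (Fin n)) (hAB : Disjoint A B) (i : Fin n) (hi : i ∈ A)
    (h : ∑ j ∈ A, om n j - ∑ j ∈ B, om n j ≤ 2 * om n i) :
    #A ≤ #(A.filter fun j => ∑ j ∈ A, om n j - ∑ j ∈ B, om n j < 2 * om n j) + 1 := by
  have hA1 := tau_nonneg A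
  have hB1 := tau_nonneg B
  have hA2 := tau_lt n A (fun j _ => j.2)
  have hB2 := tau_lt n B (fun j _ => j.2)
  have hT : (0:ℤ) < 4 ^ n := by positivity
  have hM : (4:ℤ) ^ (n+1) = 4 * 4 ^ n := by ring
  have hi0 : (0:ℤ) < 4 ^ (i:ℕ) := by positivity
  rw [om_sum, om_sum, om, hM] at h
  simp only [om_sum, hM]
  simp only [om, hM]
  set a : ℤ := (#A : ℤ) with ha
  set b : ℤ := (#B : ℤ) with hb
  set tA := ∑ j ∈ A, (4:ℤ) ^ (j : ℕ) with htA
  set tB := ∑ j ∈ B, (4:ℤ) ^ (j : ℕ) with htB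
  rcases lt_trichotomy (a - b) 2 with hab | hab | hab
  · rw [Finset.filter_true_of_mem]
    · omega
    · intro j _
      have hj : (4:ℤ) ^ (j:ℕ) ≤ 4 ^ n := pow_le_pow_right₀ (by norm_num) j.2.le
      have : (a - b) * (4 * 4^n) ≤ 1 * (4 * 4^n) := by
        apply mul_le_mul_of_nonneg_right <;> omega
      linarith
  · have e : a * (4 * 4^n) - b * (4 * 4^n) = 2 * (4 * 4^n) := by rw [← sub_mul, hab]
    have hAne : A.Nonempty := ⟨i, hi⟩
    set m := A.max' hAne with hm
    have hmA : m ∈ A := A.max'_mem hAne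
    have hBm : ∀ k ∈ B, (k:ℕ) < m := by
      intro k hk
      by_contra hcon
      have hkm : k ≠ m := fun hh => (Finset.disjoint_left.1 hAB hmA) (hh ▸ hk)
      have hkm' : (m:ℕ) < k := by
        have : (k:ℕ) ≠ m := fun hh => hkm (Fin.ext hh)
        omega
      have h1 := tau_lt k A (fun j hj => lt_of_le_of_lt (Fin.le_def.1 (A.le_max' j hj)) hkm')
      have h2 : (4:ℤ)^(k:ℕ) ≤ tB :=
        Finset.single_le_sum (f := fun j : Fin n => (4:ℤ)^(j:ℕ)) (fun _ _ => by positivity) hk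
      linarith
    have h3 := tau_lt m B hBm
    have h4 : (4:ℤ)^(m:ℕ) ≤ tA :=
      Finset.single_le_sum (f := fun j : Fin n => (4:ℤ)^(j:ℕ)) (fun _ _ => by positivity) hmA
    rw [← Finset.card_erase_add_one hmA]
    gcongr
    intro j hj
    obtain ⟨hjm, hjA⟩ := Finset.mem_erase.1 hj
    rw [Finset.mem_filter]
    refine ⟨hjA, ?_⟩
    have hlt : (j:ℕ) + 1 ≤ m := by
      have := Fin.le_def.1 (A.le_max' j hjA)
      have h' : (j:ℕ) ≠ m := fun hh => hjm (Fin.ext hh)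
      omega
    have h5 : (4:ℤ)^((j:ℕ)+1) ≤ 4^(m:ℕ) := pow_le_pow_right₀ (by norm_num) hlt
    rw [pow_succ] at h5
    linarith
  · exfalso
    have : 3 * (4 * 4^n) ≤ (a - b) * (4 * 4^n) := by
      apply mul_le_mul_of_nonneg_right <;> omega
    linarith

end comb

section region
variable {F : Type*} [Field F] [Fintype F] [LinearOrder F] {n : ℕ}

/-- region of unique minimisers of a key on cosets -/
def regK {K : Type*} [LinearOrder K] (C : Submodule F (Fin n → F)) (κ : (Fin n → F) → K) :
    Set (Fin n → F) :=
  {z | ∀ c ∈ C, c ≠ 0 → κ z < κ (z - c)}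

lemma regK_exists {K : Type*} [LinearOrder K] (C : Submodule F (Fin n → F))
    (κ : (Fin n → F) → K) (hκ : Function.Injective κ) (z : Fin n → F) :
    ∃ z' ∈ regK C κ, z - z' ∈ C := by
  classical
  obtain ⟨c, hc, hmin⟩ := Finset.exists_min_image (univ.filter fun c => c ∈ C)
    (fun c => κ (z - c)) ⟨0, by simp⟩
  have hcC : c ∈ C := (Finset.mem_filter.1 hc).2
  refine ⟨z - c, fun c' hc' hne => ?_, by simpa using hcC⟩
  have h1 := hmin (c + c') (by simpa using C.add_mem hcC hc')
  rw [← sub_sub] at h1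
  refine lt_of_le_of_ne h1 fun he => hne ?_
  exact sub_eq_self.1 (hκ he).symm

lemma regK_unique {K : Type*} [LinearOrder K] (C : Submodule F (Fin n → F))
    (κ : (Fin n → F) → K) {z z' : Fin n → F} (hz : z ∈ regK C κ) (hz' : z' ∈ regK C κ)
    (h : z - z' ∈ C) : z = z' := by
  by_contra hne
  have h1 := hz _ h (sub_ne_zero.2 hne)
  have h2 := hz' (z' - z) (by rw [← neg_sub]; exact C.neg_mem h) (sub_ne_zero.2 (Ne.symm hne))
  rw [sub_sub_cancel] at h1 h2
  exact lt_asymm h1 h2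

lemma wt_prod (p : ℝ) (z : Fin n → F) : ∏ i, wtF F p (z i) =
    (1 - p) ^ (n - hammingNorm z) * (p / ((Fintype.card F : ℝ) - 1)) ^ hammingNorm z := by
  unfold wtF
  rw [Finset.prod_ite, Finset.prod_const, Finset.prod_const]
  have h1 : #(univ.filter fun x => ¬ z x = 0) = hammingNorm z := rfl
  have h2 := Finset.card_filter_add_card_filter_not (s := (univ : Finset (Fin n))) (fun x => z x = 0)
  rw [h1] at h2 ⊢
  simp at h2
  congr 2
  omega

lemma regK_norm_eq {K K' : Type*} [LinearOrder K] [LinearOrder K'] (C : Submodule F (Fin n → F))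
    (κ : (Fin n → F) → K) (κ' : (Fin n → F) → K')
    (h : ∀ a b, κ a < κ b → hammingNorm a ≤ hammingNorm b)
    (h' : ∀ a b, κ' a < κ' b → hammingNorm a ≤ hammingNorm b)
    {z z' : Fin n → F} (hz : z ∈ regK C κ) (hz' : z' ∈ regK C κ')
    (hC : z - z' ∈ C) : hammingNorm z = hammingNorm z' := by
  by_cases hne : z = z'
  · rw [hne]
  have h1 := hz _ hC (sub_ne_zero.2 hne)
  have h2 := hz' (z' - z) (by rw [← neg_sub]; exact C.neg_mem hC) (sub_ne_zero.2 (Ne.symm hne))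
  rw [sub_sub_cancel] at h1 h2
  exact le_antisymm (h _ _ h1) (h' _ _ h2)

lemma region_swap {K K' : Type*} [LinearOrder K] [LinearOrder K'] (C : Submodule F (Fin n → F))
    (κ : (Fin n → F) → K) (κ' : (Fin n → F) → K')
    (hi : Function.Injective κ) (hi' : Function.Injective κ')
    (h : ∀ a b, κ a < κ b → hammingNorm a ≤ hammingNorm b)
    (h' : ∀ a b, κ' a < κ' b → hammingNorm a ≤ hammingNorm b) (p : ℝ) :
    noisyExpF F n p ((regK C κ).indicator 1) = noisyExpF F n p ((regK C κ').indicator 1) := by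
  classical
  simp only [noisy_eq, Set.indicator_apply, Pi.one_apply, mul_ite, mul_one, mul_zero]
  rw [← Finset.sum_filter, ← Finset.sum_filter]
  choose g hg hgC using regK_exists C κ' hi'
  refine Finset.sum_bij (fun z _ => g z) ?_ ?_ ?_ ?_
  · intro z _; simpa using hg z
  · intro z hz z' hz' he
    have := C.sub_mem (hgC z) (hgC z')
    rw [he, sub_sub_sub_cancel_right] at this
    exact regK_unique C κ (by simpa using hz) (by simpa using hz') this
  · intro y hy
    obtain ⟨z, hz, hzC⟩ := regK_exists C κ hi y
    refine ⟨z, by simpa using hz, ?_⟩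
    refine regK_unique C κ' (hg z) (by simpa using hy) ?_
    have := C.neg_mem (C.add_mem (hgC z) hzC)
    convert this using 1
    abel
  · intro z hz
    rw [wt_prod, wt_prod, regK_norm_eq C κ κ' h h' (by simpa using hz) (hg z) (hgC z)]

/-- key of the frozen order -/
def key1 (a : Fin n → F) : ℕ ×ₗ (Lex (Fin n → Bool) ×ₗ Lex (Fin n → F)) :=
  toLex (hammingNorm a, toLex (toLex (fun i => decide (a i ≠ 0)), toLex a))

lemma key1_inj : Function.Injective (key1 (F := F) (n := n)) := by
  intro a b h
  simp only [key1, toLex_inj, Prod.mk.injEq] at h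
  exact h.2.2

lemma key1_norm (a b : Fin n → F) (h : key1 a < key1 b) : hammingNorm a ≤ hammingNorm b := by
  simp only [key1, Prod.Lex.toLex_lt_toLex] at h
  rcases h with h | h
  · exact h.le
  · exact h.1.le

lemma key1_iff (a b : Fin n → F) : precRel F a b ↔ key1 a < key1 b := by
  have hdec : ∀ x y : F, (decide (x ≠ 0) = decide (y ≠ 0)) ↔ (x = 0 ↔ y = 0) := by
    intro x y; by_cases hx : x = 0 <;> by_cases hy : y = 0 <;> simp [hx, hy]
  have hlt : ∀ x y : F, (decide (x ≠ 0) < decide (y ≠ 0)) ↔ (x = 0 ∧ y ≠ 0) := by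
    intro x y; by_cases hx : x = 0 <;> by_cases hy : y = 0 <;> simp [hx, hy]
  have hsup : (∀ i, a i = 0 ↔ b i = 0) → hammingNorm a = hammingNorm b := by
    intro h
    unfold hammingNorm
    congr 1
    ext i
    simp [h i]
  have e1 : (toLex (fun i => decide (a i ≠ 0)) < toLex (fun i => decide (b i ≠ 0))) ↔
      ∃ i, a i = 0 ∧ b i ≠ 0 ∧ ∀ j, j < i → (a j = 0 ↔ b j = 0) := by
    change (∃ i, (∀ j, j < i → decide (a j ≠ 0) = decide (b j ≠ 0)) ∧
      decide (a i ≠ 0) < decide (b i ≠ 0)) ↔ _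
    simp only [hdec, hlt]
    exact exists_congr fun i => by tauto
  have e2 : (toLex a < toLex b) ↔ ∃ i, a i < b i ∧ ∀ j, j < i → a j = b j := by
    change (∃ i, (∀ j, j < i → a j = b j) ∧ a i < b i) ↔ _
    exact exists_congr fun i => by tauto
  have e3 : (toLex (fun i => decide (a i ≠ 0)) = toLex (fun i => decide (b i ≠ 0))) ↔
      ∀ i, a i = 0 ↔ b i = 0 := by
    rw [toLex_inj, funext_iff]
    simp only [hdec]
  simp only [key1, Prod.Lex.toLex_lt_toLex, precRel, e1, e2, e3]
  constructor
  · rintro (h | h | h)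
    · exact Or.inl h
    · exact Or.inr ⟨h.1, Or.inl h.2⟩
    · exact Or.inr ⟨hsup h.1, Or.inr h⟩
  · rintro (h | ⟨h, h' | h'⟩)
    · exact Or.inl h
    · exact Or.inr (Or.inl ⟨h, h'⟩)
    · exact Or.inr (Or.inr h')

lemma dec_eq_reg (C : Submodule F (Fin n → F)) : decRegion C 0 = regK C key1 := by
  ext z
  simp only [decRegion, regK, Set.mem_ofPred_eq, key1_iff, sub_zero]

/-- cost of a vector -/
def cost (a : Fin n → F) : ℤ := ∑ i, if a i = 0 then 0 else om n i

/-- key of the good order -/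
def key2 (a : Fin n → F) : ℤ ×ₗ Lex (Fin n → F) := toLex (cost a, toLex a)

lemma key2_inj : Function.Injective (key2 (F := F) (n := n)) := by
  intro a b h
  simp only [key2, toLex_inj, Prod.mk.injEq] at h
  exact h.2

lemma cost_eq (a : Fin n → F) : cost a = ∑ i ∈ univ.filter (fun i => a i ≠ 0), om n i := by
  rw [Finset.sum_filter, cost]
  exact Finset.sum_congr rfl fun i _ => by simp

lemma cost_le_of_key {a b : Fin n → F} (h : key2 a ≤ key2 b) : cost a ≤ cost b := by
  simp only [key2, Prod.Lex.toLex_le_toLex] at h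
  rcases h with h | h
  · exact h.le
  · exact h.1.le

lemma key_lt_of_cost {a b : Fin n → F} (h : cost a < cost b) : key2 a < key2 b := by
  simp only [key2, Prod.Lex.toLex_lt_toLex]
  exact Or.inl h

lemma key2_norm (a b : Fin n → F) (h : key2 a < key2 b) : hammingNorm a ≤ hammingNorm b := by
  by_contra hcon
  have h1 := cost_le_of_key h.le
  rw [cost_eq, cost_eq] at h1
  exact absurd (om_dom _ _ (not_le.1 hcon)) (not_lt.2 h1)

lemma om_pos (i : Fin n) : 0 < om n i := by
  unfold om
  rw [sub_pos]
  exact pow_lt_pow_right₀ (by norm_num) (by omega)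

lemma cost_update (a : Fin n → F) (i : Fin n) (v : F) :
    cost (Function.update a i v) = cost a - (if a i = 0 then 0 else om n i)
      + (if v = 0 then 0 else om n i) := by
  unfold cost
  rw [← Finset.add_sum_erase _ _ (mem_univ i), ← Finset.add_sum_erase univ
    (fun j => if a j = 0 then 0 else om n j) (mem_univ i)]
  have : ∑ x ∈ univ.erase i, (if Function.update a i v x = 0 then 0 else om n x) =
      ∑ x ∈ univ.erase i, (if a x = 0 then 0 else om n x) :=
    Finset.sum_congr rfl fun x hx => by
      rw [Function.update_of_ne (Finset.mem_erase.1 hx).1]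
  rw [this, Function.update_self]
  ring

lemma key2_update {a b : Fin n → F} {i : Fin n} (v : F) (hab : a i = b i) (h : key2 a < key2 b) :
    key2 (Function.update a i v) < key2 (Function.update b i v) := by
  simp only [key2, Prod.Lex.toLex_lt_toLex, cost_update, hab] at h ⊢
  rcases h with h | ⟨h1, h2⟩
  · left; linarith
  · right
    refine ⟨by rw [h1], ?_⟩
    obtain ⟨k, hk, hk'⟩ := h2
    have hki : k ≠ i := by
      rintro rfl
      exact absurd hab (ne_of_lt hk')
    refine ⟨k, fun j hj => ?_, ?_⟩
    · have := hk j hj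
      by_cases hji : j = i
      · subst hji; simp
      · simpa [Function.update_of_ne hji] using this
    · simpa [Function.update_of_ne hki] using hk'

lemma update_sub' (z c : Fin n → F) (i : Fin n) (v : F) :
    Function.update z i v - c = Function.update (z - c) i (v - c i) := by
  ext j
  by_cases h : j = i
  · subst h; simp
  · simp [h]

lemma reg_mono (C : Submodule F (Fin n → F)) (z : Fin n → F) (i : Fin n)
    (hz : z ∈ regK C key2) : Function.update z i 0 ∈ regK C key2 := by
  by_cases hzi : z i = 0
  · rwa [← hzi, Function.update_eq_self]
  intro c hc hne
  have h := hz c hc hne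
  rw [update_sub']
  by_cases hci : c i = 0
  · rw [hci, sub_zero]
    exact key2_update 0 (by simp [hci]) h
  · apply key_lt_of_cost
    rw [cost_update, cost_update]
    have h1 := cost_le_of_key h.le
    have h2 := om_pos i
    simp only [hzi, hci, zero_sub, neg_eq_zero, if_false, if_true]
    split_ifs <;> linarith

lemma cost_diff (z c : Fin n → F) : cost (z - c) - cost z =
    ∑ j ∈ univ.filter (fun j => c j ≠ 0 ∧ z j = 0), om n j -
    ∑ j ∈ univ.filter (fun j => c j ≠ 0 ∧ z j = c j), om n j := by
  rw [Finset.sum_filter, Finset.sum_filter, cost, cost, ← Finset.sum_sub_distrib,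
    ← Finset.sum_sub_distrib]
  refine Finset.sum_congr rfl fun j _ => ?_
  simp only [Pi.sub_apply, sub_eq_zero]
  by_cases h1 : c j = 0
  · simp [h1]
  · by_cases h2 : z j = 0
    · have : ¬ (0 = c j) := fun h => h1 h.symm
      simp [h1, h2, this]
    · by_cases h3 : z j = c j <;> simp [h1, h2, h3]

lemma norm_diff (z c : Fin n → F) : (hammingNorm (z - c) : ℤ) - hammingNorm z =
    #(univ.filter (fun j => c j ≠ 0 ∧ z j = 0)) -
    (#(univ.filter (fun j => c j ≠ 0 ∧ z j = c j)) : ℤ) := by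
  unfold hammingNorm
  simp only [Finset.card_filter]
  push_cast
  rw [← Finset.sum_sub_distrib, ← Finset.sum_sub_distrib]
  refine Finset.sum_congr rfl fun j _ => ?_
  simp only [Pi.sub_apply, sub_ne_zero]
  by_cases h1 : c j = 0
  · simp [h1]
  · by_cases h2 : z j = 0
    · have : ¬ (0 = c j) := fun h => h1 h.symm
      simp [h1, h2, this]
    · by_cases h3 : z j = c j <;> simp [h1, h2, h3]

lemma card_A (C : Submodule F (Fin n → F)) (z c : Fin n → F) (hz : z ∈ regK C key2)
    (hc : c ∈ C) (hne : c ≠ 0) :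
    hammingNorm c ≤ #(univ.filter (fun j => c j ≠ 0 ∧ z j = 0)) * Fintype.card F := by
  unfold hammingNorm
  rw [← Finset.card_univ (α := F)]
  refine Finset.card_le_mul_card_image_of_maps_to (f := fun j => z j / c j)
    (fun _ _ => mem_univ _) _ ?_
  intro l _
  by_cases hl : l = 0
  · apply Finset.card_le_card
    intro j hj
    simp only [Finset.mem_filter, mem_univ, true_and] at hj ⊢
    refine ⟨hj.1, ?_⟩
    have := hj.2
    rw [hl, div_eq_zero_iff] at this
    exact this.resolve_right hj.1
  · have h1 := key2_norm _ _ (hz (l • c) (C.smul_mem l hc) (smul_ne_zero hl hne))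
    have h2 := norm_diff z (l • c)
    have h3 : #(univ.filter (fun j => (l • c) j ≠ 0 ∧ z j = (l • c) j)) ≤
        #(univ.filter (fun j => (l • c) j ≠ 0 ∧ z j = 0)) := by
      omega
    simp only [Pi.smul_apply, smul_eq_mul, mul_ne_zero_iff, hl, ne_eq, not_false_eq_true,
      true_and] at h3
    refine le_trans (Finset.card_le_card ?_) h3
    intro j hj
    simp only [Finset.mem_filter, mem_univ, true_and] at hj ⊢
    refine ⟨hj.1, ?_⟩
    rw [← hj.2, div_mul_cancel₀ _ hj.1]

/-- lower bound on the number of pivotal flips -/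
lemma delta (C : Submodule F (Fin n → F)) (dmin : ℕ)
    (hdmin : ∀ c ∈ C, c ≠ 0 → dmin ≤ hammingNorm c)
    (z : Fin n → F) (hz : z ∈ regK C key2) (i : Fin n) (v : F) (hzi : z i = 0)
    (hbad : Function.update z i v ∉ regK C key2) :
    ∃ P : Finset (Fin n), dmin ≤ (#P + 1) * Fintype.card F ∧
      ∀ j ∈ P, z j = 0 ∧ ∃ w, Function.update z j w ∉ regK C key2 := by
  simp only [regK, Set.mem_ofPred_eq, not_forall, not_lt] at hbad
  obtain ⟨c, hc, hne, hle⟩ := hbad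
  have hzc := hz c hc hne
  have hci : c i ≠ 0 := by
    intro hci
    rw [update_sub', hci, sub_zero] at hle
    exact absurd (key2_update v (by simp [hci]) hzc) (not_lt.2 hle)
  have hcost := cost_le_of_key hle
  rw [update_sub', cost_update, cost_update] at hcost
  have hx : cost (z - c) - cost z ≤ 2 * om n i := by
    have := om_pos i
    have h2 : (z - c) i ≠ 0 := by simp [hzi, hci]
    rw [if_pos hzi, if_neg h2] at hcost
    split_ifs at hcost <;> linarith
  rw [cost_diff] at hx
  have hm := comb_main _ _ (by
    rw [Finset.disjoint_left]
    intro j h1 h2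
    simp only [Finset.mem_filter, mem_univ, true_and] at h1 h2
    exact h1.1 (by rw [← h2.2, h1.2])) i (by simp [hzi, hci]) hx
  refine ⟨_, (hdmin c hc hne).trans ((card_A C z c hz hc hne).trans
    (Nat.mul_le_mul_right _ hm)), ?_⟩
  intro j hj
  rw [← cost_diff] at hj
  simp only [Finset.mem_filter, mem_univ, true_and] at hj
  obtain ⟨⟨hcj, hzj⟩, hlt⟩ := hj
  refine ⟨hzj, c j, fun hin => ?_⟩
  have h1 := cost_le_of_key (hin c hc hne).le
  rw [update_sub', cost_update, cost_update] at h1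
  have h2 : (z - c) j ≠ 0 := by simp [hzj, hcj]
  simp only [hzj, hcj, h2, sub_self, if_true, if_false] at h1
  linarith

end region

section final
variable {F : Type*} [Field F] [Fintype F] [LinearOrder F] {n : ℕ}

lemma term_cases (C : Submodule F (Fin n → F)) (z : Fin n → F) (i : Fin n) (v : F)
    (hzi : z i = 0) :
    ((regK C key2).indicator (1 : (Fin n → F) → ℝ) z -
      (regK C key2).indicator (1 : (Fin n → F) → ℝ) (Function.update z i v) = 0) ∨
    ((regK C key2).indicator (1 : (Fin n → F) → ℝ) z -
      (regK C key2).indicator (1 : (Fin n → F) → ℝ) (Function.update z i v) = 1 ∧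
      z ∈ regK C key2 ∧ Function.update z i v ∉ regK C key2) := by
  by_cases h1 : z ∈ regK C key2 <;> by_cases h2 : Function.update z i v ∈ regK C key2
  · simp [h1, h2]
  · simp [h1, h2]
  · have := reg_mono C _ i h2
    rw [Function.update_idem, ← hzi, Function.update_eq_self] at this
    exact absurd this h1
  · simp [h1, h2]

lemma grad_id_eq (C : Submodule F (Fin n → F)) :
    gradF F id n ((regK C key2).indicator (1 : (Fin n → F) → ℝ)) =
    gradF F (fun x => x^2) n ((regK C key2).indicator (1 : (Fin n → F) → ℝ)) := by
  funext z
  unfold gradF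
  refine Finset.sum_congr rfl fun i _ => ?_
  split_ifs with hzi
  · refine Finset.sum_congr rfl fun v _ => ?_
    rcases term_cases C z i v hzi with h | h
    · simp [h]
    · simp [h.1]
  · rfl

lemma grad_lower (C : Submodule F (Fin n → F)) (dmin : ℕ)
    (hdmin : ∀ c ∈ C, c ≠ 0 → dmin ≤ hammingNorm c)
    (h4q : 4 * Fintype.card F ≤ dmin) (z : Fin n → F) :
    gradF F (fun x => x^2) n ((regK C key2).indicator (1 : (Fin n → F) → ℝ)) z = 0 ∨
    (dmin : ℝ) / (4 * Fintype.card F) ≤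
      gradF F (fun x => x^2) n ((regK C key2).indicator (1 : (Fin n → F) → ℝ)) z := by
  by_cases hex : z ∈ regK C key2 ∧ ∃ i v, z i = 0 ∧ Function.update z i v ∉ regK C key2
  · right
    obtain ⟨hz, i, v, hzi, hb⟩ := hex
    obtain ⟨P, hP, hPb⟩ := delta C dmin hdmin z hz i v hzi hb
    have hq : 0 < Fintype.card F := Fintype.card_pos
    have hP4 : 4 ≤ #P + 1 := Nat.le_of_mul_le_mul_right (h4q.trans hP) hq
    have h1 : (#P : ℝ) ≤
        gradF F (fun x => x^2) n ((regK C key2).indicator (1 : (Fin n → F) → ℝ)) z := by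
      unfold gradF
      have hnn : ∀ i, 0 ≤ (if z i = 0 then ∑ v, ((regK C key2).indicator (1 : (Fin n → F) → ℝ) z -
          (regK C key2).indicator (1 : (Fin n → F) → ℝ) (Function.update z i v))^2 else 0) := by
        intro i
        split_ifs
        · exact Finset.sum_nonneg fun _ _ => sq_nonneg _
        · exact le_rfl
      refine le_trans ?_ (Finset.sum_le_sum_of_subset_of_nonneg (Finset.subset_univ P)
        (fun i _ _ => hnn i))
      rw [Finset.cast_card]
      refine Finset.sum_le_sum fun j hj => ?_
      obtain ⟨hzj, w, hw⟩ := hPb j hj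
      rw [if_pos hzj]
      refine le_trans ?_ (Finset.single_le_sum (fun _ _ => sq_nonneg _) (mem_univ w))
      simp [hz, hw]
    refine le_trans ?_ h1
    have hq' : (0:ℝ) < Fintype.card F := by exact_mod_cast hq
    rw [div_le_iff₀ (by positivity)]
    have hP' : (dmin : ℝ) ≤ (#P + 1) * Fintype.card F := by exact_mod_cast hP
    have hP4' : (4:ℝ) ≤ #P + 1 := by exact_mod_cast hP4
    nlinarith
  · left
    unfold gradF
    refine Finset.sum_eq_zero fun i _ => ?_
    split_ifs with hzi
    · refine Finset.sum_eq_zero fun v _ => ?_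
      rcases term_cases C z i v hzi with h | h
      · simp [h]
      · exact absurd ⟨h.2.1, i, v, hzi, h.2.2⟩ hex
    · rfl

lemma key_bound (C : Submodule F (Fin n → F)) (dmin : ℕ)
    (hdmin : ∀ c ∈ C, c ≠ 0 → dmin ≤ hammingNorm c)
    (h4q : 4 * Fintype.card F ≤ dmin) (p : ℝ) (hp : p ∈ Set.Icc (0:ℝ) 1) :
    deriv (fun t => noisyExpF F n t ((regK C key2).indicator 1)) p ≤
      -((1 - p) / 4) * (Real.sqrt dmin / (Fintype.card F : ℝ) ^ ((3:ℝ)/2)) *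
        (noisyExpF F n p ((regK C key2).indicator 1) *
          (1 - noisyExpF F n p ((regK C key2).indicator 1))) := by
  obtain ⟨D, hD, hE, hM⟩ := deriv_exists p hp n ((regK C key2).indicator (1 : (Fin n → F) → ℝ))
  rw [hD.deriv]
  have hq := one_lt_q (F := F)
  set q : ℝ := (Fintype.card F : ℝ) with hqdef
  set f := (regK C key2).indicator (1 : (Fin n → F) → ℝ) with hf
  have hf01 : ∀ z, f z = 0 ∨ f z = 1 := fun z => by
    by_cases h : z ∈ regK C key2 <;> simp [hf, h]
  have hmon : ∀ z i, f z ≤ f (Function.update z i 0) := by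
    intro z i
    by_cases h : z ∈ regK C key2
    · simp [hf, h, reg_mono C z i h]
    · rw [hf, Set.indicator_of_notMem h]
      exact Set.indicator_nonneg (fun _ _ => by simp) _
  have hD0 := hM hmon
  rcases hp.2.eq_or_lt with hp1 | hp1
  · subst hp1; simpa using hD0
  have hp' : 0 < 1 - p := by linarith
  have hQ : 0 < q - 1 := by linarith
  set C' : ℝ := 1 / ((1 - p)^2 * (q - 1)) with hC'
  have hC0 : 0 < C' := by positivity
  have hiso := isoper hp hp1 hC0.le (by rw [← hqdef, hC']; field_simp) n f (fun z => by
    rcases hf01 z with h | h <;> simp [h])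
  set h := gradF F (fun x => x^2) n f with hh
  rw [grad_id_eq, ← hf, ← hh] at hE
  set U := noisyExpF F n p f * (1 - noisyExpF F n p f) with hU
  set Δ : ℝ := (dmin : ℝ) / (4 * q) with hΔ
  have hΔ0 : 0 ≤ Δ := by positivity
  -- pointwise
  have hpt : ∀ z, √Δ * √((f z * (1 - f z))^2 + C' * h z) ≤ √C' * h z := by
    intro z
    have e : (f z * (1 - f z))^2 = 0 := by rcases hf01 z with h | h <;> simp [h]
    rw [e, zero_add, Real.sqrt_mul hC0.le]
    rcases grad_lower C dmin hdmin h4q z with h0 | h0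
    · have h0' : h z = 0 := h0
      simp [h0']
    · have h0' : Δ ≤ h z := h0
      have : √Δ * √(h z) ≤ h z := by
        calc √Δ * √(h z) ≤ √(h z) * √(h z) := by gcongr
          _ = h z := Real.mul_self_sqrt (hΔ0.trans h0')
      nlinarith [mul_le_mul_of_nonneg_left this (Real.sqrt_nonneg C')]
  have h1 : √Δ * U ≤ √C' * noisyExpF F n p h := by
    calc √Δ * U ≤ √Δ * _ := mul_le_mul_of_nonneg_left hiso (Real.sqrt_nonneg _)
      _ = _ := (noisy_smul _ _).symm
      _ ≤ _ := noisy_mono hp hpt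
      _ = _ := noisy_smul _ _
  have hE' : noisyExpF F n p h = (1 - p) * (q - 1) * (-D) := by linarith
  have hsC : √C' * ((1 - p) * (q - 1)) = √(q - 1) := by
    have h3 : C' = (q - 1) / ((1 - p) * (q - 1))^2 := by rw [hC']; field_simp
    rw [h3, Real.sqrt_div hQ.le, Real.sqrt_sq (by positivity)]
    field_simp
  have h2 : √Δ * U ≤ √(q - 1) * (-D) := by
    rw [hE'] at h1
    calc _ ≤ _ := h1
      _ = (√C' * ((1 - p) * (q - 1))) * (-D) := by ring
      _ = _ := by rw [hsC]
  have h3 : √Δ * U ≤ √q * (-D) := h2.trans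
    (mul_le_mul_of_nonneg_right (Real.sqrt_le_sqrt (by linarith)) (by linarith))
  have hsΔ : √Δ = √dmin / (2 * √q) := by
    rw [hΔ, Real.sqrt_div (by positivity), Real.sqrt_mul (by norm_num)]
    congr 2
    rw [show (4:ℝ) = 2^2 by norm_num, Real.sqrt_sq (by norm_num)]
  have hsq : 0 < √q := Real.sqrt_pos.2 (by linarith)
  have h4 : √dmin / (2 * q) * U ≤ -D := by
    rw [hsΔ] at h3
    have : √q * (√dmin / (2 * q) * U) ≤ √q * (-D) := by
      refine le_trans (le_of_eq ?_) h3
      have hqq : q = √q * √q := (Real.mul_self_sqrt (by linarith)).symm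
      have : √dmin / (2 * q) = √dmin / (2 * (√q * √q)) := by rw [← hqq]
      rw [this]
      field_simp
    exact le_of_mul_le_mul_left this hsq
  have hg0 : 0 ≤ noisyExpF F n p f := by
    have := noisy_mono hp (f := fun _ => 0) (g := f)
      (fun z => by rcases hf01 z with h | h <;> simp [h])
    rwa [noisy_const] at this
  have hg1 : noisyExpF F n p f ≤ 1 := by
    have := noisy_mono hp (g := fun _ => 1) (f := f)
      (fun z => by rcases hf01 z with h | h <;> simp [h])
    rwa [noisy_const] at this
  have hU0 : 0 ≤ U := mul_nonneg hg0 (by linarith)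
  have hqp : q ≤ q ^ ((3:ℝ)/2) := by
    calc q = q ^ (1:ℝ) := (Real.rpow_one q).symm
      _ ≤ _ := Real.rpow_le_rpow_of_exponent_le hq.le (by norm_num)
  have hq0 : 0 < q := by linarith
  have h5 : (1 - p) / 4 * (√dmin / q ^ ((3:ℝ)/2)) ≤ √dmin / (2 * q) := by
    calc _ ≤ 1 / 2 * (√dmin / q) := by
          gcongr
          · linarith [hp.1]
          · norm_num
      _ = _ := by field_simp
  have h6 := mul_le_mul_of_nonneg_right h5 hU0
  linarith

end final

/-- Derivative bound for the ML decoding success probability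
`g(p) = Pr_{z∼p}[z ∈ Ω]` of a linear code with minimum distance `d_min ≥ 4q`. -/
theorem stmt8 {F : Type*} [Field F] [Fintype F] [LinearOrder F] (n : ℕ)
    (C : Submodule F (Fin n → F)) (dmin : ℕ)
    (hdmin : ∀ c ∈ C, c ≠ 0 → dmin ≤ hammingNorm c)
    (h4q : 4 * Fintype.card F ≤ dmin)
    (p : ℝ) (hp : p ∈ Set.Icc (0:ℝ) 1) :
    deriv (fun t => noisyExpF F n t ((decRegion C 0).indicator 1)) p ≤
      -((1 - p) / 4) * (Real.sqrt dmin / (Fintype.card F : ℝ) ^ ((3:ℝ)/2)) *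
        (noisyExpF F n p ((decRegion C 0).indicator 1) *
          (1 - noisyExpF F n p ((decRegion C 0).indicator 1))) := by
  have hs : ∀ t, noisyExpF F n t ((decRegion C 0).indicator 1) =
      noisyExpF F n t ((regK C key2).indicator 1) := fun t => by
    rw [dec_eq_reg]
    exact region_swap C key1 key2 key1_inj key2_inj key1_norm key2_norm t
  simp only [hs]
  exact key_bound C dmin hdmin h4q p hp
end

section
/- Let g : [0,1] → (0,1) be differentiable and suppose g'(p) ≤ −K·g(p)(1−g(p)) for all p, where K > 0. Then for all 0 ≤ p_0 ≤ p_1 ≤ 1, g(p_1)·(1−g(p_0)) ≤ e^{−K(p_1−p_0)}. -/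
/-- Abstract Margulis–Russo integration step: if `g : [0,1] → (0,1)` is
differentiable with `g'(p) ≤ −K·g(p)(1−g(p))`, then for `0 ≤ p₀ ≤ p₁ ≤ 1`,
`g(p₁)(1−g(p₀)) ≤ exp(−K(p₁−p₀))`. -/
theorem stmt10 (g g' : ℝ → ℝ) (K : ℝ) (hK : 0 < K)
    (hrange : ∀ p ∈ Set.Icc (0:ℝ) 1, g p ∈ Set.Ioo (0:ℝ) 1)
    (hdiff : ∀ p ∈ Set.Icc (0:ℝ) 1, HasDerivWithinAt g (g' p) (Set.Icc (0:ℝ) 1) p)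
    (hder : ∀ p ∈ Set.Icc (0:ℝ) 1, g' p ≤ -K * (g p * (1 - g p)))
    (p₀ p₁ : ℝ) (h0 : 0 ≤ p₀) (h01 : p₀ ≤ p₁) (h1 : p₁ ≤ 1) :
    g p₁ * (1 - g p₀) ≤ Real.exp (-K * (p₁ - p₀)) := by
  have hF : ∀ p ∈ Set.Icc (0:ℝ) 1, HasDerivWithinAt
      (fun p => Real.log (g p) - Real.log (1 - g p) + K * p)
      (g' p / g p - (-g' p) / (1 - g p) + K * 1) (Set.Icc (0:ℝ) 1) p := by
    intro p hp
    obtain ⟨ha, hb⟩ := hrange p hp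
    have hd := hdiff p hp
    exact ((hd.log ha.ne').sub ((hd.const_sub 1).log (by linarith))).add
      ((hasDerivWithinAt_id p _).const_mul K)
  have hanti := antitoneOn_of_hasDerivWithinAt_nonpos (convex_Icc (0:ℝ) 1)
    (fun p hp => (hF p hp).continuousWithinAt)
    (fun p hp => (hF p (interior_subset hp)).mono interior_subset)
    (fun p hp => by
      have hp' := interior_subset hp
      obtain ⟨ha, hb⟩ := hrange p hp'
      have hc : 0 < 1 - g p := by linarith
      have hd := hder p hp'
      have he : g' p / g p - (-g' p) / (1 - g p) + K * 1
          = (g' p + K * (g p * (1 - g p))) / (g p * (1 - g p)) := by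
        field_simp
        ring
      rw [he]
      exact div_nonpos_of_nonpos_of_nonneg (by linarith) (by positivity))
  have m0 : p₀ ∈ Set.Icc (0:ℝ) 1 := ⟨h0, h01.trans h1⟩
  have m1 : p₁ ∈ Set.Icc (0:ℝ) 1 := ⟨h0.trans h01, h1⟩
  have h := hanti m0 m1 h01
  obtain ⟨ha0, hb0⟩ := hrange p₀ m0
  obtain ⟨ha1, hb1⟩ := hrange p₁ m1
  have hc0 : 0 < 1 - g p₀ := by linarith
  have hc1 : 0 < 1 - g p₁ := by linarith
  have l0 : Real.log (g p₀) ≤ 0 := Real.log_nonpos ha0.le hb0.le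
  have l1 : Real.log (1 - g p₁) ≤ 0 := Real.log_nonpos hc1.le (by linarith)
  rw [← Real.log_le_iff_le_exp (mul_pos ha1 hc0), Real.log_mul ha1.ne' hc0.ne']
  simp only at h
  linarith
end
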